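/- Let P be a subset of the Euclidean plane ℝ² that is simply connected (as a topological subspace), and let p, a, b ∈ P be points such that the closed segments [p,a], [p,b] and [a,b] are all contained in P. Then for every point c of the segment [a,b], the segment [p,c] is contained in P, i.e., p sees every point of [a,b] in P. -/

import Mathlib

open unitInterval in
lemma aux_slit (r : ℂ) (h : ∀ t : ℝ, 0 ≤ t → t ≤ 1 → 1 + (t : ℂ) * (r - 1) ≠ 0)
    (t : ℝ) (h0 : 0 ≤ t) (h1 : t ≤ 1) : 1 + (t : ℂ) * (r - 1) ∈ Complex.slitPlane := by
  rw [Complex.mem_slitPlane_iff]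
  by_contra hc
  push Not at hc
  obtain ⟨hre, him⟩ := hc
  simp at hre him
  have ht : t ≠ 0 := by
    rintro rfl
    norm_num at hre
  have hi : r.im = 0 := by tauto
  have hr : 0 < 1 - r.re := by
    by_contra hh
    have : 0 ≤ t * (r.re - 1) := mul_nonneg h0 (by linarith)
    linarith
  apply h (1 / (1 - r.re)) (by positivity)
  · rw [div_le_one hr]
    nlinarith
  · have hr' : r = (r.re : ℂ) := Complex.ext (by simp) (by simp [hi])
    have hne : (1 : ℂ) - (r.re : ℂ) ≠ 0 := by exact_mod_cast hr.ne'
    rw [hr']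
    push_cast
    rw [Complex.ofReal_re]
    field_simp
    ring

open unitInterval in
lemma aux_lift (x y z0 : ℂ) (hx : Complex.exp z0 = x)
    (h : ∀ t : ℝ, 0 ≤ t → t ≤ 1 → x + (t : ℂ) * (y - x) ≠ 0) :
    y / x ∈ Complex.slitPlane ∧ ∃ L : Path z0 (z0 + Complex.log (y / x)), ∀ t : I,
      Complex.exp (L t) = x + ((t : ℝ) : ℂ) * (y - x) := by
  have hx0 : x ≠ 0 := hx ▸ Complex.exp_ne_zero _
  have hs := aux_slit (y / x) (by
    intro t h0 h1 hh
    apply h t h0 h1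
    have : x + (t : ℂ) * (y - x) = x * (1 + (t : ℂ) * (y / x - 1)) := by field_simp
    rw [this, hh, mul_zero])
  refine ⟨by simpa using hs 1 zero_le_one le_rfl, ⟨⟨fun t => z0 + Complex.log (1 + ((t : ℝ) : ℂ) * (y / x - 1)), ?_⟩, ?_, ?_⟩, ?_⟩
  · refine continuous_const.add (Continuous.clog (by fun_prop) ?_)
    intro t
    exact hs t t.2.1 t.2.2
  · simp
  · simp
  · intro t
    change Complex.exp (z0 + Complex.log (1 + ((t : ℝ) : ℂ) * (y / x - 1))) = _
    rw [Complex.exp_add, Complex.exp_log (Complex.slitPlane_ne_zero (hs t t.2.1 t.2.2)), hx]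
    field_simp

lemma aux_arith (z w : ℂ) (α β γ : ℝ) (hα : 0 < α) (hβ : 0 < β) (hγ : 0 < γ)
    (hz : z ∈ Complex.slitPlane) (hw : w ∈ Complex.slitPlane)
    (h : (α : ℂ) + β * z + γ * (z * w) = 0)
    (harg : z.arg + w.arg = (z * w).arg) : False := by
  have hz0 := Complex.slitPlane_ne_zero hz
  have e1 : β * z.im + γ * (z * w).im = 0 := by
    simpa using congrArg Complex.im h
  have h2 : (α : ℂ) * (starRingEnd ℂ z) + (β : ℂ) * Complex.normSq z
      + (γ : ℂ) * Complex.normSq z * w = 0 := by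
    have := congrArg (fun u => u * starRingEnd ℂ z) h
    simp only [zero_mul] at this
    rw [← this, Complex.normSq_eq_conj_mul_self]
    ring
  have e2 : -(α * z.im) + γ * Complex.normSq z * w.im = 0 := by
    simpa using congrArg Complex.im h2
  have hn : 0 < Complex.normSq z := Complex.normSq_pos.2 hz0
  have hgn : 0 < γ * Complex.normSq z := by positivity
  rcases lt_trichotomy z.im 0 with hi | hi | hi
  · have a1 : z.arg < 0 := Complex.arg_neg_iff.2 hi
    have a2 : w.arg < 0 := Complex.arg_neg_iff.2 (by
      by_contra hh
      nlinarith [mul_nonneg hgn.le (not_lt.1 hh), mul_pos hα (neg_pos.2 hi)])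
    have a3 : 0 ≤ (z * w).arg := Complex.arg_nonneg_iff.2 (by
      by_contra hh
      nlinarith [mul_pos hγ (neg_pos.2 (not_le.1 hh)), mul_pos hβ (neg_pos.2 hi)])
    linarith
  · have hwi : w.im = 0 := by
      rw [hi] at e2
      have : γ * Complex.normSq z * w.im = 0 := by linarith
      exact (mul_eq_zero.1 this).resolve_left hgn.ne'
    have hzr : 0 < z.re := by
      rcases Complex.mem_slitPlane_iff.1 hz with h | h
      · exact h
      · exact absurd hi h
    have hwr : 0 < w.re := by
      rcases Complex.mem_slitPlane_iff.1 hw with h | h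
      · exact h
      · exact absurd hwi h
    have := congrArg Complex.re h
    simp [hi, hwi] at this
    have : 0 < α + β * z.re + γ * (z.re * w.re) := by positivity
    linarith
  · have a1 : 0 ≤ z.arg := Complex.arg_nonneg_iff.2 hi.le
    have a2 : 0 ≤ w.arg := Complex.arg_nonneg_iff.2 (by
      by_contra hh
      nlinarith [mul_pos hgn (neg_pos.2 (not_le.1 hh)), mul_pos hα hi])
    have a3 : (z * w).arg < 0 := Complex.arg_neg_iff.2 (by
      by_contra hh
      nlinarith [mul_nonneg hγ.le (not_lt.1 hh), mul_pos hβ hi])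
    linarith

/-- The straight path in `P`. -/
noncomputable def segPath {E : Type*} [NormedAddCommGroup E] [NormedSpace ℝ E] {P : Set E} {a b : E}
    (ha : a ∈ P) (hb : b ∈ P) (h : segment ℝ a b ⊆ P) : Path (⟨a, ha⟩ : P) ⟨b, hb⟩ where
  toFun t := ⟨Path.segment a b t, h (by
    rw [← Path.range_segment]; exact ⟨t, rfl⟩)⟩
  continuous_toFun := by fun_prop
  source' := by simp
  target' := by simp

theorem sees_segment
    (P : Set (EuclideanSpace ℝ (Fin 2)))
    (hP : SimplyConnectedSpace ↥P)
    (p a b : EuclideanSpace ℝ (Fin 2))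
    (hp : p ∈ P) (ha : a ∈ P) (hb : b ∈ P)
    (hpa : segment ℝ p a ⊆ P)
    (hpb : segment ℝ p b ⊆ P)
    (hab : segment ℝ a b ⊆ P) :
    ∀ c ∈ segment ℝ a b, segment ℝ p c ⊆ P := by
  intro c hc q hq
  by_contra hqP
  -- barycentric coordinates
  obtain ⟨α, β, γ, hα, hβ, hγ, hsum, hcomb⟩ : ∃ α β γ : ℝ, 0 < α ∧ 0 < β ∧ 0 < γ ∧
      α + β + γ = 1 ∧ α • p + β • a + γ • b = q := by
    obtain ⟨s, t, hs, ht, hst, rfl⟩ := hc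
    obtain ⟨u, v, hu, hv, huv, rfl⟩ := hq
    have hu0 : u ≠ 0 := by
      rintro rfl
      obtain rfl : v = 1 := by linarith
      exact hqP (hab ⟨s, t, hs, ht, hst, by simp⟩)
    have hv0 : v ≠ 0 := by
      rintro rfl
      obtain rfl : u = 1 := by linarith
      exact hqP (by simpa using hp)
    have hs0 : s ≠ 0 := by
      rintro rfl
      obtain rfl : t = 1 := by linarith
      exact hqP (hpb ⟨u, v, hu, hv, huv, by simp⟩)
    have ht0 : t ≠ 0 := by
      rintro rfl
      obtain rfl : s = 1 := by linarith
      exact hqP (hpa ⟨u, v, hu, hv, huv, by simp⟩)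
    refine ⟨u, v * s, v * t, by positivity, by positivity, by positivity, ?_, ?_⟩
    · rw [add_assoc, ← mul_add, hst, mul_one, huv]
    · rw [smul_add, smul_smul, smul_smul, add_assoc]
  let e := Complex.orthonormalBasisOneI.repr.symm
  let φ : C(P, {z : ℂ // z ≠ 0}) := ⟨fun x => ⟨e x - e q, by
    intro h
    have : (x : EuclideanSpace ℝ (Fin 2)) = q := e.injective (sub_eq_zero.1 h)
    exact hqP (this ▸ x.2)⟩, by fun_prop⟩
  have key : ∀ {x y} (hx : x ∈ P) (hy : y ∈ P) (h : segment ℝ x y ⊆ P) (t : unitInterval),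
      ((φ (segPath hx hy h t) : {z : ℂ // z ≠ 0}) : ℂ)
        = (e x - e q) + ((t : ℝ) : ℂ) * ((e y - e q) - (e x - e q)) := by
    intro x y hx hy h t
    change e (Path.segment x y t) - e q = _
    rw [Path.segment_apply, AffineMap.lineMap_apply_module']
    simp
    ring
  have lift : ∀ {x y} (hx : x ∈ P) (hy : y ∈ P) (h : segment ℝ x y ⊆ P) (z0 : ℂ),
      Complex.exp z0 = e x - e q → 
      (e y - e q) / (e x - e q) ∈ Complex.slitPlane ∧
      ∃ L : Path z0 (z0 + Complex.log ((e y - e q) / (e x - e q))),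
        ∀ t, Complex.exp (L t) = φ (segPath hx hy h t) := by
    intro x y hx hy h z0 hz
    simp_rw [key]
    apply aux_lift _ _ _ hz
    intro t h0 h1
    rw [← key hx hy h ⟨t, h0, h1⟩]
    exact (φ _).2
  have np : e p - e q ≠ 0 := (φ ⟨p, hp⟩).2
  have na : e a - e q ≠ 0 := (φ ⟨a, ha⟩).2
  obtain ⟨s1, L1, hL1⟩ := lift hp ha hpa _ (Complex.exp_log np)
  obtain ⟨s2, L2, hL2⟩ := lift ha hb hab
    (Complex.log (e p - e q) + Complex.log ((e a - e q) / (e p - e q))) (by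
      rw [Complex.exp_add, Complex.exp_log np, Complex.exp_log (div_ne_zero na np)]
      field_simp)
  obtain ⟨s3, L3, hL3⟩ := lift hp hb hpb _ (Complex.exp_log np)
  have hom : Path.Homotopic ((segPath hp ha hpa).trans (segPath ha hb hab)) (segPath hp hb hpb) :=
    SimplyConnectedSpace.paths_homotopic _ _
  have hom2 := ContinuousMap.HomotopicRel.comp_continuousMap hom φ
  have l1 : ∀ t, Complex.exp ((L1.trans L2) t)
      = φ (((segPath hp ha hpa).trans (segPath ha hb hab)) t) := by
    intro t
    rw [Path.trans_apply, Path.trans_apply]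
    split_ifs
    · apply hL1
    · apply hL2
  have z1 : (φ.comp ((segPath hp ha hpa).trans (segPath ha hb hab)).toContinuousMap) 0
      = ⟨_, (Complex.log (e p - e q)).exp_ne_zero⟩ := by
    apply Subtype.ext
    have := l1 0
    rw [Path.source] at this
    exact this.symm
  have z3 : (φ.comp (segPath hp hb hpb).toContinuousMap) 0
      = ⟨_, (Complex.log (e p - e q)).exp_ne_zero⟩ := by
    apply Subtype.ext
    have := hL3 0
    rw [Path.source] at this
    exact this.symm
  have hend := Complex.isCoveringMap_exp.liftPath_apply_one_eq_of_homotopicRel hom2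
    (Complex.log (e p - e q)) z1 z3
  have g1 := (Complex.isCoveringMap_exp.eq_liftPath_iff' z1
    (Γ := (L1.trans L2).toContinuousMap)).2
      ⟨by funext t; exact Subtype.ext (l1 t), by simp⟩
  have g3 := (Complex.isCoveringMap_exp.eq_liftPath_iff' z3
    (Γ := L3.toContinuousMap)).2
      ⟨by funext t; exact Subtype.ext (hL3 t), by simp⟩
  rw [← g1, ← g3] at hend
  have hend' : (L1.trans L2) 1 = L3 1 := hend
  rw [Path.target, Path.target] at hend'
  have hm : (e a - e q) / (e p - e q) * ((e b - e q) / (e a - e q))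
      = (e b - e q) / (e p - e q) := by field_simp
  have hbary : (α : ℂ) * (e p - e q) + β * (e a - e q) + γ * (e b - e q) = 0 := by
    have h1 : (α : ℂ) + β + γ = 1 := by exact_mod_cast hsum
    have h2 : (α : ℂ) * e p + β * e a + γ * e b = e q := by
      rw [← hcomb]; simp
    linear_combination h2 - e q * h1
  refine aux_arith _ _ α β γ hα hβ hγ s1 s2 ?_ ?_
  · rw [hm]
    have : (α : ℂ) + β * ((e a - e q) / (e p - e q)) + γ * ((e b - e q) / (e p - e q))
      = (α * (e p - e q) + β * (e a - e q) + γ * (e b - e q)) / (e p - e q) := by field_simp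
    rw [this, hbary, zero_div]
  · rw [hm]
    have := congrArg Complex.im hend'
    simp only [Complex.add_im, Complex.log_im] at this
    linarith
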